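/- Let 𝒳 = {(0,0), (1,0), (0,1), (−1,0), (0,−1), (−1,−1)} ⊂ ℝ². There do not exist matrices S, T̄ ∈ ℝ^{2×2}, both of rank 2, such that 𝒮((0,0);S,T̄) = 𝒳; consequently 𝒳 cannot be expressed as a minimal poised set for the GSH at the point x⁰ = (0,0). -/

import Mathlib

open Matrix

noncomputable section

/-- the `j`-th column of a matrix, as a vector -/
def mcol {n m : Type*} (S : Matrix n m ℝ) (j : m) : n → ℝ := fun i => S i j

/-- the set of all points used in the computation of the generalized simplex Hessian
`∇²_s f(x⁰;S,T̄)` -/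
def gshSet {n m k : ℕ} (x0 : Fin n → ℝ) (S : Matrix (Fin n) (Fin m) ℝ)
    (T : Matrix (Fin n) (Fin k) ℝ) : Set (Fin n → ℝ) :=
  {x0} ∪ (Set.range fun i => x0 + mcol S i) ∪ (Set.range fun j => x0 + mcol T j)
    ∪ (Set.range fun p : Fin m × Fin k => x0 + mcol S p.1 + mcol T p.2)

/-- `𝒮(x⁰;S,T̄)` is a minimal poised set for the GSH at `x⁰` -/
def IsMinimalPoisedGSH {n : ℕ} (x0 : Fin n → ℝ) (S T : Matrix (Fin n) (Fin n) ℝ) : Prop :=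
  S.rank = n ∧ T.rank = n ∧ (gshSet x0 S T).ncard = (n + 1) * (n + 2) / 2

/-- The six points (0,0), (1,0), (0,1), (-1,0), (0,-1), (-1,-1) of the plane. -/
def exampleSet : Set (Fin 2 → ℝ) :=
  {![0, 0], ![1, 0], ![0, 1], ![-1, 0], ![0, -1], ![-1, -1]}

lemma linearIndependent_mcol_of_rank_eq {n : ℕ} {S : Matrix (Fin n) (Fin n) ℝ}
    (h : S.rank = n) : LinearIndependent ℝ (mcol S) := by
  rw [linearIndependent_iff_card_eq_finrank_span, Fintype.card_fin]
  exact h.symm.trans S.rank_eq_finrank_span_cols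

/-- Join two nonzero points of the example set when their sum lies in the set again. The resulting
graph is a pentagon, listed here by neighbours. -/
lemma add_mem_example_set {u v : Fin 2 → ℝ} (hu : u ≠ 0) (hv : v ≠ 0)
    (hum : u ∈ exampleSet) (hvm : v ∈ exampleSet) (huv : u + v ∈ exampleSet) :
    (u = ![1, 0] ∧ (v = ![-1, 0] ∨ v = ![-1, -1])) ∨
    (u = ![0, 1] ∧ (v = ![0, -1] ∨ v = ![-1, -1])) ∨
    (u = ![-1, 0] ∧ (v = ![1, 0] ∨ v = ![0, -1])) ∨
    (u = ![0, -1] ∧ (v = ![0, 1] ∨ v = ![-1, 0])) ∨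
    (u = ![-1, -1] ∧ (v = ![1, 0] ∨ v = ![0, 1])) := by
  simp only [exampleSet, Set.mem_insert_iff, Set.mem_singleton_iff] at hum hvm huv
  rcases hum with rfl | rfl | rfl | rfl | rfl | rfl <;>
  rcases hvm with rfl | rfl | rfl | rfl | rfl | rfl <;>
  revert hu hv huv <;> norm_num [funext_iff, Fin.forall_fin_two]

/-- No two distinct points of the pentagon have two common neighbours. -/
lemma eq_of_add_mem_example_set {s s' t t' : Fin 2 → ℝ}
    (hs0 : s ≠ 0) (hs0' : s' ≠ 0) (ht0 : t ≠ 0) (ht0' : t' ≠ 0) (hss : s ≠ s')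
    (hs : s ∈ exampleSet)
    (hs' : s' ∈ exampleSet)
    (ht : t ∈ exampleSet)
    (ht' : t' ∈ exampleSet)
    (h₁ : s + t ∈ exampleSet)
    (h₂ : s + t' ∈ exampleSet)
    (h₃ : s' + t ∈ exampleSet)
    (h₄ : s' + t' ∈ exampleSet) :
    t = t' := by
  have a₁ := add_mem_example_set hs0 ht0 hs ht h₁
  have a₂ := add_mem_example_set hs0 ht0' hs ht' h₂
  have a₃ := add_mem_example_set hs0' ht0 hs' ht h₃
  have a₄ := add_mem_example_set hs0' ht0' hs' ht' h₄
  clear hs hs' ht ht' h₁ h₂ h₃ h₄ hs0 hs0' ht0 ht0'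
  rcases a₁ with ⟨rfl, rfl | rfl⟩ | ⟨rfl, rfl | rfl⟩ | ⟨rfl, rfl | rfl⟩ | ⟨rfl, rfl | rfl⟩ |
    ⟨rfl, rfl | rfl⟩ <;>
  norm_num [funext_iff, Fin.forall_fin_two] at a₂ a₃ a₄ hss ⊢ <;> grind

lemma gshSet_ne_example_set {S T : Matrix (Fin 2) (Fin 2) ℝ} (hS : S.rank = 2)
    (hT : T.rank = 2) :
    gshSet ![0, 0] S T ≠ exampleSet := by
  intro h
  have lS := linearIndependent_mcol_of_rank_eq hS
  have lT := linearIndependent_mcol_of_rank_eq hT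
  have h0 : (![0, 0] : Fin 2 → ℝ) = 0 := by simp
  have mS (i : Fin 2) : mcol S i ∈ exampleSet := by
    rw [← h]
    exact .inl (.inl (.inr ⟨i, by simp [h0]⟩))
  have mT (j : Fin 2) : mcol T j ∈ exampleSet := by
    rw [← h]
    exact .inl (.inr ⟨j, by simp [h0]⟩)
  have mST (i j : Fin 2) : mcol S i + mcol T j ∈ exampleSet := by
    rw [← h]
    exact .inr ⟨(i, j), by simp [h0]⟩
  have key := eq_of_add_mem_example_set (lS.ne_zero 0) (lS.ne_zero 1) (lT.ne_zero 0)
    (lT.ne_zero 1) (lS.injective.ne zero_ne_one) (mS 0) (mS 1) (mT 0) (mT 1)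
    (mST 0 0) (mST 0 1) (mST 1 0) (mST 1 1)
  exact zero_ne_one (lT.injective key)

theorem example_set_not_minimal_poised :
    (¬ ∃ S T : Matrix (Fin 2) (Fin 2) ℝ, S.rank = 2 ∧ T.rank = 2 ∧
      gshSet ![0, 0] S T
        = ({![0, 0], ![1, 0], ![0, 1], ![-1, 0], ![0, -1], ![-1, -1]} :
            Set (Fin 2 → ℝ))) ∧
    (¬ ∃ S T : Matrix (Fin 2) (Fin 2) ℝ, IsMinimalPoisedGSH ![0, 0] S T ∧
      gshSet ![0, 0] S T
        = ({![0, 0], ![1, 0], ![0, 1], ![-1, 0], ![0, -1], ![-1, -1]} :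
            Set (Fin 2 → ℝ))) := by
  exact ⟨fun ⟨_, _, hS, hT, h⟩ => gshSet_ne_example_set hS hT h,
    fun ⟨_, _, ⟨hS, hT, _⟩, h⟩ => gshSet_ne_example_set hS hT h⟩
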